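/- arXiv:2406.11144 — 10 statements merged into one kernel-verified Lean document; each statement's English description precedes it below -/
import Mathlib

section
/- Let N ≥ 1 and let f_1, …, f_N : ℝⁿ → ℝ with f(x) := (1/N) ∑_{i=1}^N f_i(x). Fix x ∈ ℝⁿ and constants κ₀, μ₀, κ_f > 0 such that |f_i(x)| ≤ κ₀ + μ₀ |f(x)| for every i ∈ {1,…,N} and |f(x)| ≤ κ_f. Then for every nonempty subset S ⊆ {1,…,N}, one has |f(x) − (1/|S|) ∑_{i∈S} f_i(x)| ≤ 2 ((N − |S|)/N) (κ₀ + μ₀ κ_f). -/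
open Finset

/-- The mean of a bounded family and its mean over a nonempty subset differ by at most twice the
bound times the proportion of omitted indices. -/
theorem abs_mean_sub_mean_subset_le {ι : Type*} [Fintype ι] {a : ι → ℝ} {C : ℝ}
    (ha : ∀ i, |a i| ≤ C) {S : Finset ι} (hS : S.Nonempty) :
    |(1 / (Fintype.card ι : ℝ)) * ∑ i, a i - (1 / (S.card : ℝ)) * ∑ i ∈ S, a i| ≤
      2 * (((Fintype.card ι : ℝ) - S.card) / Fintype.card ι) * C := by
  classical
  have sum_le (T : Finset ι) : |∑ i ∈ T, a i| ≤ T.card * C := by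
    simpa using (Finset.abs_sum_le_sum_abs a T).trans (Finset.sum_le_sum fun i _ => ha i)
  have hs : (0 : ℝ) < S.card := by exact_mod_cast hS.card_pos
  have hsN : (S.card : ℝ) ≤ Fintype.card ι := by exact_mod_cast Finset.card_le_univ S
  have hN : (0 : ℝ) < Fintype.card ι := hs.trans_le hsN
  have hcompl : |∑ i ∈ Sᶜ, a i| ≤ ((Fintype.card ι : ℝ) - S.card) * C := by
    simpa [Finset.card_compl, Nat.cast_sub (Finset.card_le_univ S)] using sum_le Sᶜ
  rw [← Finset.sum_add_sum_compl S a]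
  set N : ℝ := (Fintype.card ι : ℝ)
  set s : ℝ := (S.card : ℝ)
  have hNs : 0 ≤ (N - s) / (N * s) := div_nonneg (sub_nonneg.2 hsN) (by positivity)
  calc |1 / N * (∑ i ∈ S, a i + ∑ i ∈ Sᶜ, a i) - 1 / s * ∑ i ∈ S, a i|
      = |1 / N * ∑ i ∈ Sᶜ, a i - (N - s) / (N * s) * ∑ i ∈ S, a i| := by
        congr 1
        field_simp
        ring
    _ ≤ |1 / N * ∑ i ∈ Sᶜ, a i| + |(N - s) / (N * s) * ∑ i ∈ S, a i| := abs_sub _ _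
    _ = 1 / N * |∑ i ∈ Sᶜ, a i| + (N - s) / (N * s) * |∑ i ∈ S, a i| := by
        rw [abs_mul, abs_mul, abs_of_nonneg hNs, abs_of_pos (one_div_pos.2 hN)]
    _ ≤ 1 / N * ((N - s) * C) + (N - s) / (N * s) * (s * C) := by
        gcongr
        exact sum_le S
    _ = 2 * ((N - s) / N) * C := by
        field_simp
        ring

theorem stmt_0 (n N : ℕ) (hN : 1 ≤ N)
    (fi : Fin N → EuclideanSpace ℝ (Fin n) → ℝ)
    (f : EuclideanSpace ℝ (Fin n) → ℝ)
    (hf : ∀ z, f z = (1 / (N : ℝ)) * ∑ i, fi i z)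
    (x : EuclideanSpace ℝ (Fin n)) (κ₀ μ₀ κf : ℝ)
    (hκ₀ : 0 < κ₀) (hμ₀ : 0 < μ₀) (hκf : 0 < κf)
    (hbound : ∀ i, |fi i x| ≤ κ₀ + μ₀ * |f x|)
    (hfb : |f x| ≤ κf)
    (S : Finset (Fin N)) (hS : S.Nonempty) :
    |f x - (1 / (S.card : ℝ)) * ∑ i ∈ S, fi i x| ≤
      2 * (((N : ℝ) - (S.card : ℝ)) / (N : ℝ)) * (κ₀ + μ₀ * κf) := by
  have hC : ∀ i, |fi i x| ≤ κ₀ + μ₀ * κf := fun i => (hbound i).trans (by gcongr)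
  simpa only [hf x, Fintype.card_fin] using abs_mean_sub_mean_subset_le hC hS
end

section
/- Let N ≥ 1 and let f_1, …, f_N : ℝⁿ → ℝ be differentiable with f(x) := (1/N) ∑_{i=1}^N f_i(x). Fix x ∈ ℝⁿ and constants κ₁, μ₁, κ_g > 0 such that ‖∇f_i(x)‖ ≤ κ₁ + μ₁ ‖∇f(x)‖ for every i ∈ {1,…,N} and ‖∇f(x)‖ ≤ κ_g, where ‖·‖ is the Euclidean norm on ℝⁿ. Then for every nonempty subset S ⊆ {1,…,N}, one has ‖∇f(x) − (1/|S|) ∑_{i∈S} ∇f_i(x)‖ ≤ 2 ((N − |S|)/N) (κ₁ + μ₁ κ_g). -/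
open Finset

/-- The gradient of a scaled finite sum of differentiable functions. -/
theorem gradient_const_mul_sum {ι E : Type*} [NormedAddCommGroup E] [InnerProductSpace ℝ E]
    [CompleteSpace E] (s : Finset ι) (c : ℝ) {f : ι → E → ℝ} {x : E}
    (hf : ∀ i ∈ s, DifferentiableAt ℝ (f i) x) :
    gradient (fun z => c * ∑ i ∈ s, f i z) x = c • ∑ i ∈ s, gradient (f i) x := by
  have h : HasFDerivAt (fun z => c * ∑ i ∈ s, f i z) (c • ∑ i ∈ s, fderiv ℝ (f i) x) x :=
    (HasFDerivAt.fun_sum fun i hi => (hf i hi).hasFDerivAt).const_mul c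
  simp [gradient, h.fderiv, map_sum]

/-- The mean over a nonempty subset `S` of a finite family bounded by `K` differs from the mean of
the whole family by at most `2 K` times the proportion of omitted indices. -/
theorem norm_mean_sub_mean_subset_le {ι E : Type*} [Fintype ι] [NormedAddCommGroup E]
    [NormedSpace ℝ E] {g : ι → E} {K : ℝ} (hg : ∀ i, ‖g i‖ ≤ K) {S : Finset ι}
    (hS : S.Nonempty) :
    ‖(1 / (Fintype.card ι : ℝ)) • ∑ i, g i - (1 / (#S : ℝ)) • ∑ i ∈ S, g i‖ ≤
      2 * (((Fintype.card ι : ℝ) - #S) / Fintype.card ι) * K := by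
  classical
  have hs : (0 : ℝ) < #S := by exact_mod_cast hS.card_pos
  have hle : (#S : ℝ) ≤ Fintype.card ι := by exact_mod_cast card_le_univ S
  have hn : (0 : ℝ) < Fintype.card ι := hs.trans_le hle
  have hc : (#Sᶜ : ℝ) = Fintype.card ι - #S := by
    rw [card_compl, Nat.cast_sub (card_le_univ S)]
  have sum_le (T : Finset ι) : ‖∑ i ∈ T, g i‖ ≤ #T * K := by
    simpa using norm_sum_le_of_le T fun i _ => hg i
  have hinv : 0 ≤ 1 / (#S : ℝ) - 1 / Fintype.card ι :=
    sub_nonneg.2 (one_div_le_one_div_of_le hs hle)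
  calc
    _ = ‖(1 / (Fintype.card ι : ℝ)) • ∑ i ∈ Sᶜ, g i -
          (1 / (#S : ℝ) - 1 / Fintype.card ι) • ∑ i ∈ S, g i‖ := by
      rw [← sum_compl_add_sum S g]
      congr 1
      module
    _ ≤ 1 / (Fintype.card ι : ℝ) * ‖∑ i ∈ Sᶜ, g i‖ +
          (1 / (#S : ℝ) - 1 / Fintype.card ι) * ‖∑ i ∈ S, g i‖ := by
      refine (norm_sub_le _ _).trans_eq ?_
      rw [norm_smul_of_nonneg (by positivity), norm_smul_of_nonneg hinv]
    _ ≤ 1 / (Fintype.card ι : ℝ) * (#Sᶜ * K) +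
          (1 / (#S : ℝ) - 1 / Fintype.card ι) * (#S * K) := by
      gcongr <;> exact sum_le _
    _ = _ := by
      rw [hc]
      field_simp
      ring

theorem stmt_1 (n N : ℕ) (hN : 1 ≤ N)
    (fi : Fin N → EuclideanSpace ℝ (Fin n) → ℝ)
    (hdiff : ∀ i, Differentiable ℝ (fi i))
    (f : EuclideanSpace ℝ (Fin n) → ℝ)
    (hf : ∀ z, f z = (1 / (N : ℝ)) * ∑ i, fi i z)
    (x : EuclideanSpace ℝ (Fin n)) (κ₁ μ₁ κg : ℝ)
    (hκ₁ : 0 < κ₁) (hμ₁ : 0 < μ₁) (hκg : 0 < κg)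
    (hbound : ∀ i, ‖gradient (fi i) x‖ ≤ κ₁ + μ₁ * ‖gradient f x‖)
    (hgb : ‖gradient f x‖ ≤ κg)
    (S : Finset (Fin N)) (hS : S.Nonempty) :
    ‖gradient f x - (1 / (S.card : ℝ)) • ∑ i ∈ S, gradient (fi i) x‖ ≤
      2 * (((N : ℝ) - (S.card : ℝ)) / (N : ℝ)) * (κ₁ + μ₁ * κg) := by
  have hgrad : gradient f x = (1 / (N : ℝ)) • ∑ i, gradient (fi i) x := by
    rw [funext hf]
    exact gradient_const_mul_sum univ _ fun i _ => hdiff i x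
  have hK (i : Fin N) : ‖gradient (fi i) x‖ ≤ κ₁ + μ₁ * κg :=
    (hbound i).trans (by gcongr)
  rw [hgrad]
  simpa only [Fintype.card_fin] using norm_mean_sub_mean_subset_le hK hS
end

section
/- Let c = (c_1, …, c_m) : ℝⁿ → ℝᵐ be differentiable with each gradient ∇c_i Lipschitz continuous on ℝⁿ with constant Γ_{1,i}, and set Γ₁ := ∑_{i=1}^m Γ_{1,i}. Let x, d ∈ ℝⁿ satisfy ∇c(x)ᵀ d = −c(x) (i.e., ∇c_i(x)ᵀ d = −c_i(x) for each i). Then for every α ∈ [0,1], ‖c(x + α d)‖₁ ≤ (1 − α) ‖c(x)‖₁ + (Γ₁/2) α² ‖d‖², where ‖·‖₁ is the ℓ1 norm on ℝᵐ and ‖·‖ the Euclidean norm on ℝⁿ. -/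
open Finset

/-- The remainder of the first-order expansion of a function with Lipschitz derivative is
quadratic in the step. -/
theorem norm_sub_linearization_le_of_lipschitz_fderiv {E F : Type*}
    [NormedAddCommGroup E] [NormedSpace ℝ E] [NormedAddCommGroup F] [NormedSpace ℝ F]
    {f : E → F} {K : ℝ} (hf : Differentiable ℝ f)
    (hK : ∀ a b, ‖fderiv ℝ f a - fderiv ℝ f b‖ ≤ K * ‖a - b‖)
    (x d : E) {t : ℝ} (ht : 0 ≤ t) :
    ‖f (x + t • d) - f x - t • fderiv ℝ f x d‖ ≤ K / 2 * t ^ 2 * ‖d‖ ^ 2 := by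
  have hderiv : ∀ s : ℝ, HasDerivAt (fun s : ℝ => f (x + s • d) - f x - s • fderiv ℝ f x d)
      (fderiv ℝ f (x + s • d) d - fderiv ℝ f x d) s := by
    intro s
    have hline : HasDerivAt (fun s : ℝ => x + s • d) d s := by
      simpa using ((hasDerivAt_id s).smul_const d).const_add x
    have hlinear : HasDerivAt (fun s : ℝ => s • fderiv ℝ f x d) (fderiv ℝ f x d) s := by
      simpa using (hasDerivAt_id s).smul_const (fderiv ℝ f x d)
    exact (((hf _).hasFDerivAt.comp_hasDerivAt s hline).sub_const (f x)).sub hlinear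
  have hbound : ∀ s : ℝ, HasDerivAt (fun s : ℝ => K / 2 * s ^ 2 * ‖d‖ ^ 2)
      (K * s * ‖d‖ ^ 2) s := by
    intro s
    refine (((hasDerivAt_pow 2 s).const_mul (K / 2)).mul_const (‖d‖ ^ 2)).congr_deriv ?_
    push_cast
    ring
  refine image_norm_le_of_norm_deriv_right_le_deriv_boundary (a := 0) (b := t)
    (fun s _ => (hderiv s).continuousAt.continuousWithinAt)
    (fun s _ => (hderiv s).hasDerivWithinAt) (by simp) hbound ?_ ⟨ht, le_rfl⟩
  intro s hs
  calc ‖fderiv ℝ f (x + s • d) d - fderiv ℝ f x d‖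
      ≤ ‖fderiv ℝ f (x + s • d) - fderiv ℝ f x‖ * ‖d‖ :=
        (fderiv ℝ f (x + s • d) - fderiv ℝ f x).le_opNorm d
    _ ≤ K * ‖x + s • d - x‖ * ‖d‖ := by gcongr; exact hK _ _
    _ = K * s * ‖d‖ ^ 2 := by
        rw [add_sub_cancel_left, norm_smul, Real.norm_of_nonneg hs.1]
        ring

theorem stmt_6 (n m : ℕ) (c : Fin m → EuclideanSpace ℝ (Fin n) → ℝ)
    (hdiff : ∀ i, Differentiable ℝ (c i))
    (Γ₁i : Fin m → ℝ)
    (hLip : ∀ i, ∀ a b, ‖fderiv ℝ (c i) a - fderiv ℝ (c i) b‖ ≤ Γ₁i i * ‖a - b‖)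
    (x d : EuclideanSpace ℝ (Fin n))
    (hlin : ∀ i, fderiv ℝ (c i) x d = -(c i x)) :
    ∀ α : ℝ, α ∈ Set.Icc (0 : ℝ) 1 →
      ∑ i, |c i (x + α • d)| ≤
        (1 - α) * ∑ i, |c i x| + ((∑ i, Γ₁i i) / 2) * α ^ 2 * ‖d‖ ^ 2 := by
  intro α hα
  rw [Finset.mul_sum, Finset.sum_div, Finset.sum_mul, Finset.sum_mul, ← Finset.sum_add_distrib]
  refine Finset.sum_le_sum fun i _ => ?_
  have hrem := norm_sub_linearization_le_of_lipschitz_fderiv (hdiff i) (hLip i) x d hα.1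
  rw [hlin i, Real.norm_eq_abs, smul_eq_mul] at hrem
  calc |c i (x + α • d)|
      = |(1 - α) * c i x + (c i (x + α • d) - c i x - α * -(c i x))| := by congr 1; ring
    _ ≤ |(1 - α) * c i x| + |c i (x + α • d) - c i x - α * -(c i x)| := abs_add_le _ _
    _ ≤ (1 - α) * |c i x| + Γ₁i i / 2 * α ^ 2 * ‖d‖ ^ 2 := by
        rw [abs_mul, abs_of_nonneg (sub_nonneg.2 hα.2)]
        gcongr
end

section
/- Let c = (c_1, …, c_m) : ℝⁿ → ℝᵐ be twice differentiable with each Hessian ∇²c_i Lipschitz continuous on ℝⁿ with constant Γ_{2,i}, and set Γ₂ := ∑_{i=1}^m Γ_{2,i}. Let x, d ∈ ℝⁿ satisfy ∇c(x)ᵀ d = −c(x). Then for every α ∈ [0,1], ‖c(x + α d)‖₁ ≤ (1 − α) ‖c(x)‖₁ + (α²/2) ∑_{i=1}^m |dᵀ ∇²c_i(x) d| + (α³/6) Γ₂ ‖d‖³, where ‖·‖₁ is the ℓ1 norm on ℝᵐ and ‖·‖ the Euclidean norm on ℝⁿ. -/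
open Finset

theorem norm_taylor_two_sub_le_of_lipschitz_fderiv_fderiv
    {E F : Type*} [NormedAddCommGroup E] [NormedSpace ℝ E]
    [NormedAddCommGroup F] [NormedSpace ℝ F] {f : E → F} {K : ℝ}
    (hf : Differentiable ℝ f) (hf' : Differentiable ℝ (fderiv ℝ f))
    (hK : ∀ a b, ‖fderiv ℝ (fderiv ℝ f) a - fderiv ℝ (fderiv ℝ f) b‖ ≤ K * ‖a - b‖)
    (x d : E) {t : ℝ} (ht : 0 ≤ t) :
    ‖f (x + t • d) - f x - t • fderiv ℝ f x d - (t ^ 2 / 2) • fderiv ℝ (fderiv ℝ f) x d d‖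
      ≤ t ^ 3 / 6 * K * ‖d‖ ^ 3 := by
  have hline (s : ℝ) : HasDerivAt (fun s : ℝ => x + s • d) d s := by
    simpa using ((hasDerivAt_id s).smul_const d).const_add x
  have hquad (s : ℝ) : HasDerivAt (fun s : ℝ => s ^ 2 / 2) s s := by
    simpa using ((hasDerivAt_id s).pow 2).div_const 2
  have hcubic (s : ℝ) : HasDerivAt (fun s : ℝ => s ^ 3 / 6) (s ^ 2 / 2) s :=
    ((hasDerivAt_pow 3 s).div_const 6).congr_deriv (by push_cast; ring)
  have hfirst (s : ℝ) : HasDerivAt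
      (fun s : ℝ => fderiv ℝ f (x + s • d) d - fderiv ℝ f x d - s • fderiv ℝ (fderiv ℝ f) x d d)
      (fderiv ℝ (fderiv ℝ f) (x + s • d) d d - fderiv ℝ (fderiv ℝ f) x d d) s := by
    have h : HasDerivAt (fun s : ℝ => fderiv ℝ f (x + s • d))
        (fderiv ℝ (fderiv ℝ f) (x + s • d) d) s :=
      (hf' (x + s • d)).hasFDerivAt.comp_hasDerivAt s (hline s)
    have happ : HasDerivAt (fun s : ℝ => fderiv ℝ f (x + s • d) d)
        (fderiv ℝ (fderiv ℝ f) (x + s • d) d d) s := by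
      simpa using h.clm_apply (hasDerivAt_const s d)
    simpa using! (happ.sub_const (fderiv ℝ f x d)).sub
      ((hasDerivAt_id s).smul_const (fderiv ℝ (fderiv ℝ f) x d d))
  have hzero (s : ℝ) : HasDerivAt
      (fun s : ℝ => f (x + s • d) - f x - s • fderiv ℝ f x d
        - (s ^ 2 / 2) • fderiv ℝ (fderiv ℝ f) x d d)
      (fderiv ℝ f (x + s • d) d - fderiv ℝ f x d - s • fderiv ℝ (fderiv ℝ f) x d d) s := by
    have h : HasDerivAt (fun s : ℝ => f (x + s • d)) (fderiv ℝ f (x + s • d) d) s :=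
      (hf (x + s • d)).hasFDerivAt.comp_hasDerivAt s (hline s)
    simpa using! ((h.sub_const (f x)).sub ((hasDerivAt_id s).smul_const (fderiv ℝ f x d))).sub
      ((hquad s).smul_const (fderiv ℝ (fderiv ℝ f) x d d))
  have hsecond_le {s : ℝ} (hs : 0 ≤ s) :
      ‖fderiv ℝ (fderiv ℝ f) (x + s • d) d d - fderiv ℝ (fderiv ℝ f) x d d‖
        ≤ s * (K * ‖d‖ ^ 3) := by
    calc
      _ ≤ ‖fderiv ℝ (fderiv ℝ f) (x + s • d) - fderiv ℝ (fderiv ℝ f) x‖ * ‖d‖ * ‖d‖ :=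
        (fderiv ℝ (fderiv ℝ f) (x + s • d) - fderiv ℝ (fderiv ℝ f) x).le_opNorm₂ d d
      _ ≤ K * ‖(x + s • d) - x‖ * ‖d‖ * ‖d‖ := by gcongr; exact hK _ _
      _ = s * (K * ‖d‖ ^ 3) := by
        rw [add_sub_cancel_left, norm_smul, Real.norm_of_nonneg hs]
        ring
  have hfirst_le {s : ℝ} (hs : 0 ≤ s) :
      ‖fderiv ℝ f (x + s • d) d - fderiv ℝ f x d - s • fderiv ℝ (fderiv ℝ f) x d d‖
        ≤ s ^ 2 / 2 * (K * ‖d‖ ^ 3) :=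
    image_norm_le_of_norm_deriv_right_le_deriv_boundary
      (fun u _ => (hfirst u).continuousAt.continuousWithinAt)
      (fun u _ => (hfirst u).hasDerivWithinAt) (by simp)
      (fun u => (hquad u).mul_const (K * ‖d‖ ^ 3))
      (fun _ hu => hsecond_le hu.1) (Set.right_mem_Icc.2 hs)
  rw [mul_assoc]
  exact image_norm_le_of_norm_deriv_right_le_deriv_boundary
    (fun u _ => (hzero u).continuousAt.continuousWithinAt)
    (fun u _ => (hzero u).hasDerivWithinAt) (by simp)
    (fun u => (hcubic u).mul_const (K * ‖d‖ ^ 3))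
    (fun _ hu => hfirst_le hu.1) (Set.right_mem_Icc.2 ht)

open Finset

theorem stmt_7 (n m : ℕ) (c : Fin m → EuclideanSpace ℝ (Fin n) → ℝ)
    (hdiff : ∀ i, Differentiable ℝ (c i))
    (hdiff2 : ∀ i, Differentiable ℝ (fderiv ℝ (c i)))
    (Γ₂i : Fin m → ℝ)
    (hLip : ∀ i, ∀ a b,
      ‖fderiv ℝ (fderiv ℝ (c i)) a - fderiv ℝ (fderiv ℝ (c i)) b‖ ≤ Γ₂i i * ‖a - b‖)
    (x d : EuclideanSpace ℝ (Fin n))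
    (hlin : ∀ i, fderiv ℝ (c i) x d = -(c i x)) :
    ∀ α : ℝ, α ∈ Set.Icc (0 : ℝ) 1 →
      ∑ i, |c i (x + α • d)| ≤
        (1 - α) * ∑ i, |c i x|
          + (α ^ 2 / 2) * ∑ i, |fderiv ℝ (fderiv ℝ (c i)) x d d|
          + (α ^ 3 / 6) * (∑ i, Γ₂i i) * ‖d‖ ^ 3 := by
  rintro α ⟨hα₀, hα₁⟩
  rw [mul_sum, mul_sum, mul_sum, sum_mul, ← sum_add_distrib, ← sum_add_distrib]
  refine sum_le_sum fun i _ => ?_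
  have h := norm_taylor_two_sub_le_of_lipschitz_fderiv_fderiv (hdiff i) (hdiff2 i) (hLip i) x d hα₀
  rw [hlin i, Real.norm_eq_abs, smul_eq_mul, smul_eq_mul] at h
  set q := fderiv ℝ (fderiv ℝ (c i)) x d d
  calc
    |c i (x + α • d)|
        = |(1 - α) * c i x + α ^ 2 / 2 * q
            + (c i (x + α • d) - c i x - α * -(c i x) - α ^ 2 / 2 * q)| := by
      congr 1
      ring
    _ ≤ |(1 - α) * c i x| + |α ^ 2 / 2 * q|
          + |c i (x + α • d) - c i x - α * -(c i x) - α ^ 2 / 2 * q| := abs_add_three _ _ _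
    _ ≤ (1 - α) * |c i x| + α ^ 2 / 2 * |q| + α ^ 3 / 6 * Γ₂i i * ‖d‖ ^ 3 := by
      rw [abs_mul, abs_mul, abs_of_nonneg (sub_nonneg.2 hα₁), abs_of_nonneg (by positivity : 0 ≤ α ^ 2 / 2)]
      gcongr
end

section
/- Let f : ℝⁿ → ℝ be differentiable with ∇f Lipschitz continuous with constant L₁, and let c = (c_1, …, c_m) : ℝⁿ → ℝᵐ be differentiable with each ∇c_i Lipschitz continuous with constant Γ_{1,i}, Γ₁ := ∑_i Γ_{1,i}. Let τ > 0 and let x, d ∈ ℝⁿ satisfy ∇c(x)ᵀ d = −c(x). Then for every α ∈ [0,1], φ(x + α d, τ) − φ(x, τ) ≤ −α Δl(x, τ, ∇f(x), d) + ((τ L₁ + Γ₁)/2) α² ‖d‖², where φ(x, τ) := τ f(x) + ‖c(x)‖₁ and Δl(x, τ, g, d) := −τ gᵀd + ‖c(x)‖₁. -/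
open Finset

/-- Quadratic bound on the first-order Taylor remainder of a function whose derivative is
Lipschitz continuous. -/
theorem norm_sub_sub_fderiv_le_of_fderiv_lipschitz {E F : Type*}
    [NormedAddCommGroup E] [NormedSpace ℝ E] [NormedAddCommGroup F] [NormedSpace ℝ F]
    {g : E → F} (hg : Differentiable ℝ g) {L : ℝ}
    (hL : ∀ a b, ‖fderiv ℝ g a - fderiv ℝ g b‖ ≤ L * ‖a - b‖) (x v : E) :
    ‖g (x + v) - g x - fderiv ℝ g x v‖ ≤ L / 2 * ‖v‖ ^ 2 := by
  have hd : ∀ t : ℝ, HasDerivAt (fun t : ℝ => g (x + t • v) - g x - t • fderiv ℝ g x v)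
      (fderiv ℝ g (x + t • v) v - fderiv ℝ g x v) t := by
    intro t
    have hline : HasDerivAt (fun t : ℝ => x + t • v) v t := by
      simpa using ((hasDerivAt_id t).smul_const v).const_add x
    have hlin : HasDerivAt (fun t : ℝ => t • fderiv ℝ g x v) (fderiv ℝ g x v) t := by
      simpa using (hasDerivAt_id t).smul_const (fderiv ℝ g x v)
    exact (((hg _).hasFDerivAt.comp_hasDerivAt t hline).sub_const (g x)).sub hlin
  have hB : ∀ t : ℝ, HasDerivAt (fun t : ℝ => L / 2 * ‖v‖ ^ 2 * t ^ 2)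
      (L * ‖v‖ ^ 2 * t) t := by
    intro t
    refine ((hasDerivAt_pow 2 t).const_mul (L / 2 * ‖v‖ ^ 2)).congr_deriv ?_
    norm_num
    ring
  have key := image_norm_le_of_norm_deriv_right_le_deriv_boundary (a := 0) (b := 1)
    (fun t _ => (hd t).continuousAt.continuousWithinAt)
    (fun t _ => (hd t).hasDerivWithinAt) (by simp) hB
    (fun t ht => by
      calc ‖fderiv ℝ g (x + t • v) v - fderiv ℝ g x v‖
          ≤ ‖fderiv ℝ g (x + t • v) - fderiv ℝ g x‖ * ‖v‖ :=
            (fderiv ℝ g (x + t • v) - fderiv ℝ g x).le_opNorm v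
        _ ≤ L * ‖x + t • v - x‖ * ‖v‖ := by gcongr; exact hL _ _
        _ = L * ‖v‖ ^ 2 * t := by
            rw [add_sub_cancel_left, norm_smul, Real.norm_of_nonneg ht.1]
            ring)
    (Set.right_mem_Icc.2 zero_le_one)
  simpa using key

theorem stmt_8 (n m : ℕ)
    (f : EuclideanSpace ℝ (Fin n) → ℝ) (hfd : Differentiable ℝ f)
    (L₁ : ℝ) (hfLip : ∀ a b, ‖fderiv ℝ f a - fderiv ℝ f b‖ ≤ L₁ * ‖a - b‖)
    (c : Fin m → EuclideanSpace ℝ (Fin n) → ℝ) (hcd : ∀ i, Differentiable ℝ (c i))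
    (Γ₁i : Fin m → ℝ)
    (hcLip : ∀ i, ∀ a b, ‖fderiv ℝ (c i) a - fderiv ℝ (c i) b‖ ≤ Γ₁i i * ‖a - b‖)
    (τ : ℝ) (hτ : 0 < τ)
    (x d : EuclideanSpace ℝ (Fin n))
    (hlin : ∀ i, fderiv ℝ (c i) x d = -(c i x)) :
    ∀ α : ℝ, α ∈ Set.Icc (0 : ℝ) 1 →
      (τ * f (x + α • d) + ∑ i, |c i (x + α • d)|) - (τ * f x + ∑ i, |c i x|) ≤
        -α * (-(τ * fderiv ℝ f x d) + ∑ i, |c i x|)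
          + ((τ * L₁ + ∑ i, Γ₁i i) / 2) * α ^ 2 * ‖d‖ ^ 2 := by
  rintro α ⟨hα0, hα1⟩
  have hnorm : ‖α • d‖ ^ 2 = α ^ 2 * ‖d‖ ^ 2 := by
    rw [norm_smul, mul_pow, Real.norm_eq_abs, sq_abs]
  have hf : f (x + α • d) - f x ≤ α * fderiv ℝ f x d + L₁ / 2 * (α ^ 2 * ‖d‖ ^ 2) := by
    have h := norm_sub_sub_fderiv_le_of_fderiv_lipschitz hfd hfLip x (α • d)
    rw [hnorm, map_smul, smul_eq_mul, Real.norm_eq_abs] at h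
    linarith [le_of_abs_le h]
  have hc : ∀ i, |c i (x + α • d)| ≤ (1 - α) * |c i x| + Γ₁i i * (α ^ 2 * ‖d‖ ^ 2 / 2) := by
    intro i
    have h := norm_sub_sub_fderiv_le_of_fderiv_lipschitz (hcd i) (hcLip i) x (α • d)
    rw [hnorm, map_smul, smul_eq_mul, Real.norm_eq_abs, hlin] at h
    have h' := abs_add_le ((1 - α) * c i x) (c i (x + α • d) - c i x - α * -c i x)
    rw [abs_mul, abs_of_nonneg (sub_nonneg.2 hα1),
      show (1 - α) * c i x + (c i (x + α • d) - c i x - α * -c i x) = c i (x + α • d) by ring]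
      at h'
    linarith
  have hsum := Finset.sum_le_sum fun i (_ : i ∈ Finset.univ) => hc i
  rw [Finset.sum_add_distrib, ← Finset.mul_sum, ← Finset.sum_mul] at hsum
  have hτf := mul_le_mul_of_nonneg_left hf hτ.le
  linarith
end

section
/- Let f : ℝⁿ → ℝ be twice differentiable with ∇²f Lipschitz continuous with constant L₂, and let c = (c_1, …, c_m) : ℝⁿ → ℝᵐ be twice differentiable with each ∇²c_i Lipschitz continuous with constant Γ_{2,i}, Γ₂ := ∑_i Γ_{2,i}. Let τ > 0 and let x, d ∈ ℝⁿ satisfy ∇c(x)ᵀ d = −c(x). Then for every α ∈ [0,1], φ(x + α d, τ) − φ(x, τ) ≤ −α Δl(x, τ, ∇f(x), d) + (α²/2) [ τ dᵀ∇²f(x)d + ∑_{i=1}^m |dᵀ∇²c_i(x)d| ] + (α³/6)(τ L₂ + Γ₂) ‖d‖³, where φ(x, τ) := τ f(x) + ‖c(x)‖₁ and Δl(x, τ, g, d) := −τ gᵀd + ‖c(x)‖₁. -/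
open Finset

/-- Second-order Taylor estimate along a line for a function whose second derivative satisfies a
Lipschitz bound. -/
theorem norm_taylor_two_remainder_le {E F : Type*} [NormedAddCommGroup E] [NormedSpace ℝ E]
    [NormedAddCommGroup F] [NormedSpace ℝ F] {h : E → F} (hd : Differentiable ℝ h)
    (hd2 : Differentiable ℝ (fderiv ℝ h)) {L : ℝ}
    (hL : ∀ a b, ‖fderiv ℝ (fderiv ℝ h) a - fderiv ℝ (fderiv ℝ h) b‖ ≤ L * ‖a - b‖)
    (x d : E) {α : ℝ} (hα : 0 ≤ α) :
    ‖h (x + α • d) - h x - α • fderiv ℝ h x d - (α ^ 2 / 2) • fderiv ℝ (fderiv ℝ h) x d d‖ ≤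
      α ^ 3 / 6 * L * ‖d‖ ^ 3 := by
  have hline (t : ℝ) : HasDerivAt (fun s : ℝ => x + s • d) d t := by
    simpa using ((hasDerivAt_id t).smul_const d).const_add x
  have hsq (t : ℝ) : HasDerivAt (fun s : ℝ => s ^ 2 / 2) t t :=
    ((hasDerivAt_pow 2 t).div_const 2).congr_deriv (by simp)
  have h1 (t : ℝ) : HasDerivAt (fun s : ℝ => fderiv ℝ h (x + s • d) d - fderiv ℝ h x d
      - s • fderiv ℝ (fderiv ℝ h) x d d)
      (fderiv ℝ (fderiv ℝ h) (x + t • d) d d - fderiv ℝ (fderiv ℝ h) x d d) t := by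
    have := (((hd2 _).hasFDerivAt.comp_hasDerivAt t (hline t)).clm_apply
      (hasDerivAt_const t d)).sub_const (fderiv ℝ h x d) |>.sub
      ((hasDerivAt_id t).smul_const (fderiv ℝ (fderiv ℝ h) x d d))
    exact this.congr_deriv (by simp)
  have h0 (t : ℝ) : HasDerivAt (fun s : ℝ => h (x + s • d) - h x - s • fderiv ℝ h x d
      - (s ^ 2 / 2) • fderiv ℝ (fderiv ℝ h) x d d)
      (fderiv ℝ h (x + t • d) d - fderiv ℝ h x d - t • fderiv ℝ (fderiv ℝ h) x d d) t := by
    have := (((hd _).hasFDerivAt.comp_hasDerivAt t (hline t)).sub_const (h x)).sub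
      ((hasDerivAt_id t).smul_const (fderiv ℝ h x d)) |>.sub
      ((hsq t).smul_const (fderiv ℝ (fderiv ℝ h) x d d))
    exact this.congr_deriv (by simp)
  have b1 (t : ℝ) (ht : 0 ≤ t) : ‖fderiv ℝ h (x + t • d) d - fderiv ℝ h x d
      - t • fderiv ℝ (fderiv ℝ h) x d d‖ ≤ t ^ 2 / 2 * (L * ‖d‖ ^ 3) := by
    refine image_norm_le_of_norm_deriv_right_le_deriv_boundary (a := 0) (b := t)
      (fun s _ => (h1 s).continuousAt.continuousWithinAt)
      (fun s _ => (h1 s).hasDerivWithinAt) (by simp)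
      (fun s => (hsq s).mul_const (L * ‖d‖ ^ 3)) (fun s hs => ?_) ⟨ht, le_rfl⟩
    calc ‖fderiv ℝ (fderiv ℝ h) (x + s • d) d d - fderiv ℝ (fderiv ℝ h) x d d‖
        ≤ ‖fderiv ℝ (fderiv ℝ h) (x + s • d) - fderiv ℝ (fderiv ℝ h) x‖ * ‖d‖ * ‖d‖ :=
          (fderiv ℝ (fderiv ℝ h) (x + s • d) - fderiv ℝ (fderiv ℝ h) x).le_opNorm₂ d d
      _ ≤ L * ‖x + s • d - x‖ * ‖d‖ * ‖d‖ := by gcongr; exact hL _ _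
      _ = s * (L * ‖d‖ ^ 3) := by
          rw [add_sub_cancel_left, norm_smul, Real.norm_of_nonneg hs.1]; ring
  have hcube (t : ℝ) : HasDerivAt (fun s : ℝ => s ^ 3 / 6 * L * ‖d‖ ^ 3)
      (t ^ 2 / 2 * (L * ‖d‖ ^ 3)) t := by
    have := (((hasDerivAt_pow 3 t).div_const 6).mul_const L).mul_const (‖d‖ ^ 3)
    exact this.congr_deriv (by push_cast; ring)
  exact image_norm_le_of_norm_deriv_right_le_deriv_boundary (a := 0) (b := α)
    (fun s _ => (h0 s).continuousAt.continuousWithinAt)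
    (fun s _ => (h0 s).hasDerivWithinAt) (by simp) hcube (fun s hs => b1 s hs.1) ⟨hα, le_rfl⟩

theorem stmt_9 (n m : ℕ)
    (f : EuclideanSpace ℝ (Fin n) → ℝ)
    (hfd : Differentiable ℝ f) (hfd2 : Differentiable ℝ (fderiv ℝ f))
    (L₂ : ℝ)
    (hfLip : ∀ a b, ‖fderiv ℝ (fderiv ℝ f) a - fderiv ℝ (fderiv ℝ f) b‖ ≤ L₂ * ‖a - b‖)
    (c : Fin m → EuclideanSpace ℝ (Fin n) → ℝ)
    (hcd : ∀ i, Differentiable ℝ (c i)) (hcd2 : ∀ i, Differentiable ℝ (fderiv ℝ (c i)))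
    (Γ₂i : Fin m → ℝ)
    (hcLip : ∀ i, ∀ a b,
      ‖fderiv ℝ (fderiv ℝ (c i)) a - fderiv ℝ (fderiv ℝ (c i)) b‖ ≤ Γ₂i i * ‖a - b‖)
    (τ : ℝ) (hτ : 0 < τ)
    (x d : EuclideanSpace ℝ (Fin n))
    (hlin : ∀ i, fderiv ℝ (c i) x d = -(c i x)) :
    ∀ α : ℝ, α ∈ Set.Icc (0 : ℝ) 1 →
      (τ * f (x + α • d) + ∑ i, |c i (x + α • d)|) - (τ * f x + ∑ i, |c i x|) ≤
        -α * (-(τ * fderiv ℝ f x d) + ∑ i, |c i x|)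
          + (α ^ 2 / 2) *
            (τ * fderiv ℝ (fderiv ℝ f) x d d + ∑ i, |fderiv ℝ (fderiv ℝ (c i)) x d d|)
          + (α ^ 3 / 6) * (τ * L₂ + ∑ i, Γ₂i i) * ‖d‖ ^ 3 := by
  rintro α ⟨hα0, hα1⟩
  have hf : τ * (f (x + α • d) - f x - α * fderiv ℝ f x d
      - α ^ 2 / 2 * fderiv ℝ (fderiv ℝ f) x d d) ≤ τ * (α ^ 3 / 6 * L₂ * ‖d‖ ^ 3) :=
    mul_le_mul_of_nonneg_left
      ((le_abs_self _).trans (norm_taylor_two_remainder_le hfd hfd2 hfLip x d hα0)) hτ.le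
  have hc (i : Fin m) : |c i (x + α • d)| ≤ (1 - α) * |c i x|
      + α ^ 2 / 2 * |fderiv ℝ (fderiv ℝ (c i)) x d d| + α ^ 3 / 6 * Γ₂i i * ‖d‖ ^ 3 := by
    have h := norm_taylor_two_remainder_le (hcd i) (hcd2 i) (hcLip i) x d hα0
    rw [hlin i, Real.norm_eq_abs, smul_eq_mul, smul_eq_mul] at h
    calc |c i (x + α • d)|
        = |(1 - α) * c i x + α ^ 2 / 2 * fderiv ℝ (fderiv ℝ (c i)) x d d
            + (c i (x + α • d) - c i x - α * -(c i x)
              - α ^ 2 / 2 * fderiv ℝ (fderiv ℝ (c i)) x d d)| := by congr 1; ring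
      _ ≤ _ := abs_add_three _ _ _
      _ ≤ _ := by
        rw [abs_mul, abs_mul, abs_of_nonneg (sub_nonneg.2 hα1), abs_of_nonneg (by positivity : 0 ≤ α ^ 2 / 2)]
        gcongr
  have hsum := sum_le_sum fun i (_ : i ∈ univ) => hc i
  simp only [sum_add_distrib, ← mul_sum, ← sum_mul] at hsum
  linarith
end

section
/- Under the hypotheses of the modified line search acceptance lemma — f : ℝⁿ → ℝ twice differentiable with ∇²f Lipschitz with constant L₂; c = (c_1,…,c_m) twice differentiable with each ∇²c_i Lipschitz with constant Γ_{2,i}, Γ₂ := ∑_i Γ_{2,i}; τ > 0, η ∈ (0,1), κ_l > 0; x, d ∈ ℝⁿ with ∇c(x)ᵀ d = −c(x); ḡ ∈ ℝⁿ with Δl := −τ ḡᵀd + ‖c(x)‖₁ ≥ κ_l τ ‖d‖²; H̄ an n×n matrix with ‖H̄ − ∇²f(x)‖ ≤ ε̄_H < 2(1 − η) κ_l in operator norm; f̄ with |f̄(x) − f(x)| ≤ ε_f, |f̄(x + d) − f(x + d)| ≤ ε_f; and ε_A ≥ τ ‖∇f(x) − ḡ‖ ‖d‖ + 2 τ ε_f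 — if additionally ‖d‖ ≤ τ (6 κ_l (1 − η) − 3 ε̄_H) / (τ L₂ + Γ₂), then the unit step size is accepted by the modified line search condition: τ f̄(x + d) + ‖c(x + d)‖₁ ≤ τ f̄(x) + ‖c(x)‖₁ − η Δl + (1/2) τ dᵀ H̄ d + (1/2) ∑_{i=1}^m |dᵀ∇²c_i(x)d| + ε_A. -/
open Finset RealInnerProductSpace

/-- Third-order bound for a function on `[0, 1]` whose value and derivative vanish at `0`. -/
lemma abs_apply_one_le_of_abs_second_deriv_le {h h' h'' : ℝ → ℝ} {C : ℝ}
    (hh : ∀ t, HasDerivAt h (h' t) t) (hh' : ∀ t, HasDerivAt h' (h'' t) t)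
    (h0 : h 0 = 0) (h0' : h' 0 = 0) (hC : ∀ t, 0 ≤ t → |h'' t| ≤ C * t) :
    |h 1| ≤ C / 6 := by
  have first : ∀ t ∈ Set.Icc (0 : ℝ) 1, ‖h' t‖ ≤ C / 2 * t ^ 2 := fun t ht =>
    image_norm_le_of_norm_deriv_right_le_deriv_boundary (B := fun t => C / 2 * t ^ 2)
      (B' := fun t => C * t)
      (fun t _ => (hh' t).continuousAt.continuousWithinAt)
      (fun t _ => (hh' t).hasDerivWithinAt) (by simp [h0'])
      (fun t => ((hasDerivAt_pow 2 t).const_mul (C / 2)).congr_deriv (by norm_num; ring))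
      (fun t ht => hC t ht.1) ht
  have second := image_norm_le_of_norm_deriv_right_le_deriv_boundary
      (B := fun t => C / 6 * t ^ 3) (B' := fun t => C / 2 * t ^ 2)
      (fun t _ => (hh t).continuousAt.continuousWithinAt)
      (fun t _ => (hh t).hasDerivWithinAt) (by simp [h0])
      (fun t => ((hasDerivAt_pow 3 t).const_mul (C / 6)).congr_deriv (by norm_num; ring))
      (fun t ht => first t (Set.Ico_subset_Icc_self ht)) (Set.right_mem_Icc.2 zero_le_one)
  simpa using second

/-- Second-order Taylor expansion with cubic remainder for a Lipschitz second derivative. -/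
lemma abs_sub_taylor_two_le {E : Type*} [NormedAddCommGroup E] [NormedSpace ℝ E]
    {g : E → ℝ} (hg : Differentiable ℝ g) (hg2 : Differentiable ℝ (fderiv ℝ g)) {L : ℝ}
    (hL : ∀ a b, ‖fderiv ℝ (fderiv ℝ g) a - fderiv ℝ (fderiv ℝ g) b‖ ≤ L * ‖a - b‖) (x d : E) :
    |g (x + d) - g x - fderiv ℝ g x d - 1 / 2 * fderiv ℝ (fderiv ℝ g) x d d|
      ≤ L / 6 * ‖d‖ ^ 3 := by
  have line : ∀ t : ℝ, HasDerivAt (fun s : ℝ => x + s • d) d t := fun t => by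
    simpa using ((hasDerivAt_id t).smul_const d).const_add x
  have key := abs_apply_one_le_of_abs_second_deriv_le
    (h := fun t => g (x + t • d) - g x - t * fderiv ℝ g x d
      - t ^ 2 * (1 / 2 * fderiv ℝ (fderiv ℝ g) x d d))
    (h' := fun t => fderiv ℝ g (x + t • d) d - fderiv ℝ g x d
      - t * fderiv ℝ (fderiv ℝ g) x d d)
    (h'' := fun t => fderiv ℝ (fderiv ℝ g) (x + t • d) d d - fderiv ℝ (fderiv ℝ g) x d d)
    (C := L * ‖d‖ ^ 3) ?_ ?_ (by simp) (by simp) ?_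
  · convert key using 1
    · simp
    · ring
  · intro t
    have h1 := (hg (x + t • d)).hasFDerivAt.comp_hasDerivAt t (line t)
    exact (((h1.sub_const (g x)).sub ((hasDerivAt_id t).mul_const _)).sub
      ((hasDerivAt_pow 2 t).mul_const _)).congr_deriv (by norm_num; ring)
  · intro t
    have h1 : HasDerivAt (fun s : ℝ => fderiv ℝ g (x + s • d))
        (fderiv ℝ (fderiv ℝ g) (x + t • d) d) t :=
      (hg2 (x + t • d)).hasFDerivAt.comp_hasDerivAt t (line t)
    have h2 : HasDerivAt (fun s : ℝ => fderiv ℝ g (x + s • d) d)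
        (fderiv ℝ (fderiv ℝ g) (x + t • d) d d) t := by
      simpa using h1.clm_apply (hasDerivAt_const t d)
    exact ((h2.sub_const (fderiv ℝ g x d)).sub ((hasDerivAt_id t).mul_const _)).congr_deriv
      (by simp)
  · intro t ht
    calc _ ≤ ‖fderiv ℝ (fderiv ℝ g) (x + t • d) - fderiv ℝ (fderiv ℝ g) x‖ * ‖d‖ * ‖d‖ :=
          (fderiv ℝ (fderiv ℝ g) (x + t • d) - fderiv ℝ (fderiv ℝ g) x).le_opNorm₂ d d
      _ ≤ L * ‖x + t • d - x‖ * ‖d‖ * ‖d‖ := by gcongr; exact hL _ _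
      _ = L * ‖d‖ ^ 3 * t := by
          rw [add_sub_cancel_left, norm_smul, Real.norm_of_nonneg ht]; ring

theorem stmt_12 (n m : ℕ)
    (f : EuclideanSpace ℝ (Fin n) → ℝ)
    (hfd : Differentiable ℝ f) (hfd2 : Differentiable ℝ (fderiv ℝ f))
    (L₂ : ℝ)
    (hfLip : ∀ a b, ‖fderiv ℝ (fderiv ℝ f) a - fderiv ℝ (fderiv ℝ f) b‖ ≤ L₂ * ‖a - b‖)
    (c : Fin m → EuclideanSpace ℝ (Fin n) → ℝ)
    (hcd : ∀ i, Differentiable ℝ (c i)) (hcd2 : ∀ i, Differentiable ℝ (fderiv ℝ (c i)))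
    (Γ₂i : Fin m → ℝ)
    (hcLip : ∀ i, ∀ a b,
      ‖fderiv ℝ (fderiv ℝ (c i)) a - fderiv ℝ (fderiv ℝ (c i)) b‖ ≤ Γ₂i i * ‖a - b‖)
    (τ η κl : ℝ) (hτ : 0 < τ) (hη : η ∈ Set.Ioo (0 : ℝ) 1) (hκl : 0 < κl)
    (x d : EuclideanSpace ℝ (Fin n))
    (hlin : ∀ i, fderiv ℝ (c i) x d = -(c i x))
    (gbar : EuclideanSpace ℝ (Fin n))
    (Δl : ℝ) (hΔl : Δl = -(τ * ⟪gbar, d⟫) + ∑ i, |c i x|)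
    (hΔllb : κl * τ * ‖d‖ ^ 2 ≤ Δl)
    (Hbar : EuclideanSpace ℝ (Fin n) →L[ℝ] EuclideanSpace ℝ (Fin n) →L[ℝ] ℝ)
    (εbarH : ℝ) (hεH0 : 0 ≤ εbarH) (hεHlt : εbarH < 2 * (1 - η) * κl)
    (hHbar : ‖Hbar - fderiv ℝ (fderiv ℝ f) x‖ ≤ εbarH)
    (fbar : EuclideanSpace ℝ (Fin n) → ℝ) (εf εA : ℝ) (hεf : 0 ≤ εf) (hεA0 : 0 ≤ εA)
    (hfbar0 : |fbar x - f x| ≤ εf)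
    (hfbar1 : |fbar (x + d) - f (x + d)| ≤ εf)
    (hεAge : τ * ‖gradient f x - gbar‖ * ‖d‖ + 2 * τ * εf ≤ εA)
    (hdsmall : ‖d‖ ≤ τ * (6 * κl * (1 - η) - 3 * εbarH) / (τ * L₂ + ∑ i, Γ₂i i)) :
    τ * fbar (x + d) + ∑ i, |c i (x + d)| ≤
      τ * fbar x + ∑ i, |c i x| - η * Δl
        + (1 / 2) * (τ * Hbar d d)
        + (1 / 2) * ∑ i, |fderiv ℝ (fderiv ℝ (c i)) x d d|
        + εA := by
  have hnum : 0 < τ * (6 * κl * (1 - η) - 3 * εbarH) := mul_pos hτ (by linarith)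
  have hstep : (τ * L₂ + ∑ i, Γ₂i i) * ‖d‖ ≤ τ * (6 * κl * (1 - η) - 3 * εbarH) := by
    rcases le_or_gt (τ * L₂ + ∑ i, Γ₂i i) 0 with hS | hS
    · exact (mul_nonpos_of_nonpos_of_nonneg hS (norm_nonneg d)).trans hnum.le
    · rw [mul_comm]
      exact (le_div_iff₀ hS).1 hdsmall
  have hcubic := mul_le_mul_of_nonneg_right hstep (sq_nonneg ‖d‖)
  have hf := mul_le_mul_of_nonneg_left
    (abs_le.1 (abs_sub_taylor_two_le hfd hfd2 hfLip x d)).2 hτ.le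
  have hc : ∑ i, |c i (x + d)| ≤
      1 / 2 * ∑ i, |fderiv ℝ (fderiv ℝ (c i)) x d d| + (∑ i, Γ₂i i) / 6 * ‖d‖ ^ 3 := by
    rw [Finset.mul_sum, Finset.sum_div, Finset.sum_mul, ← Finset.sum_add_distrib]
    refine Finset.sum_le_sum fun i _ => ?_
    have h1 := abs_le.1 (abs_sub_taylor_two_le (hcd i) (hcd2 i) (hcLip i) x d)
    rw [hlin i] at h1
    have h2 := le_abs_self (fderiv ℝ (fderiv ℝ (c i)) x d d)
    have h3 := neg_abs_le (fderiv ℝ (fderiv ℝ (c i)) x d d)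
    exact abs_le.2 ⟨by linarith, by linarith⟩
  have hH : fderiv ℝ (fderiv ℝ f) x d d - Hbar d d ≤ εbarH * ‖d‖ ^ 2 := by
    have h1 := (Hbar - fderiv ℝ (fderiv ℝ f) x).le_opNorm₂ d d
    have h2 : ‖Hbar - fderiv ℝ (fderiv ℝ f) x‖ * ‖d‖ * ‖d‖ ≤ εbarH * ‖d‖ * ‖d‖ := by gcongr
    have h3 := (abs_le.1 (h1.trans h2)).1
    simp only [sub_apply] at h3
    linarith
  have hgrad : fderiv ℝ f x d - ⟪gbar, d⟫ ≤ ‖gradient f x - gbar‖ * ‖d‖ := by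
    have h1 := real_inner_le_norm (gradient f x - gbar) d
    rwa [inner_sub_left, gradient, InnerProductSpace.toDual_symm_apply] at h1
  have hH' := mul_le_mul_of_nonneg_left hH hτ.le
  have hgrad' := mul_le_mul_of_nonneg_left hgrad hτ.le
  have hfx := mul_le_mul_of_nonneg_left (abs_le.1 hfbar0).1 hτ.le
  have hfxd := mul_le_mul_of_nonneg_left (abs_le.1 hfbar1).2 hτ.le
  have hred := mul_le_mul_of_nonneg_left hΔllb (sub_nonneg.2 hη.2.le)
  linarith
end

section
/- Let {β_k}_{k∈ℕ} be a real sequence with 0 < β_{k+1} < β_k for all k and β₀ ≤ 1, and let {θ_k}_{k∈ℕ} ⊆ [0, 1] be nonincreasing. Define ξ₀ = 1 and, for k ≥ 0, ρ_k := ξ_k/6 + θ_k/4 + β_k^{k/4}/2 and ξ_{k+1} := max{ξ_k ρ_k, β_{k+1}^{(k+1)/4}}. Then ρ_k ≤ 11/12 for every k ≥ 0, and ξ_k < 1 for every k ≥ 1. -/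
theorem stmt_16 (β θ ξ ρ : ℕ → ℝ)
    (hβpos : ∀ k, 0 < β k) (hβdec : ∀ k, β (k + 1) < β k) (hβ0 : β 0 ≤ 1)
    (hθmem : ∀ k, θ k ∈ Set.Icc (0 : ℝ) 1) (hθmono : ∀ k, θ (k + 1) ≤ θ k)
    (hξ0 : ξ 0 = 1)
    (hρ : ∀ k, ρ k = ξ k / 6 + θ k / 4 + β k ^ ((k : ℝ) / 4) / 2)
    (hξ : ∀ k, ξ (k + 1) = max (ξ k * ρ k) (β (k + 1) ^ (((k : ℝ) + 1) / 4))) :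
    (∀ k, ρ k ≤ 11 / 12) ∧ (∀ k, 1 ≤ k → ξ k < 1) := by
  have hβle : ∀ k, β k ≤ 1 := fun k =>
    (antitone_nat_of_succ_le (fun n => (hβdec n).le) k.zero_le).trans hβ0
  have hρle : ∀ k, ξ k ≤ 1 → ρ k ≤ 11 / 12 := fun k hk => by
    have hpow : β k ^ ((k : ℝ) / 4) ≤ 1 :=
      Real.rpow_le_one (hβpos k).le (hβle k) (by positivity)
    linarith [hρ k, (hθmem k).2]
  have hlt : ∀ k, 0 < ξ k → ξ k ≤ 1 → ξ (k + 1) < 1 := fun k hpos hle => by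
    rw [hξ k]
    refine max_lt (by nlinarith [hρle k hle]) ?_
    exact Real.rpow_lt_one (hβpos _).le ((hβdec k).trans_le (hβle k)) (by positivity)
  have hbound : ∀ k, 0 < ξ k ∧ ξ k ≤ 1 := fun k => by
    induction k with
    | zero => simp [hξ0]
    | succ k ih =>
      refine ⟨?_, (hlt k ih.1 ih.2).le⟩
      rw [hξ k]
      exact lt_max_of_lt_right (Real.rpow_pos_of_pos (hβpos _) _)
  refine ⟨fun k => hρle k (hbound k).2, fun k hk => ?_⟩
  obtain ⟨n, rfl⟩ := Nat.exists_eq_add_of_le' hk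
  exact hlt n (hbound n).1 (hbound n).2
end

section
/- Let {β_k}_{k∈ℕ} satisfy 0 < β_{k+1} < β_k for all k, β₀ ≤ 1 and β_k → 0, and let {θ_k}_{k∈ℕ} ⊆ [0, 1] be nonincreasing with θ_k → 0. Define ξ₀ = 1, ρ_k := ξ_k/6 + θ_k/4 + β_k^{k/4}/2, and ξ_{k+1} := max{ξ_k ρ_k, β_{k+1}^{(k+1)/4}}. Let C > 0 and let {a_k}_{k∈ℕ} be nonnegative reals with a₀ ≤ C and, for every k, a_{k+1} ≤ a_k²/(6C) + (θ_k/4) a_k + (C/2) β_k^{k/2}. Then: (i) a_k ≤ C ξ_k for every k (in particular a_k ≤ C for all k); (ii) ξ_k → 0 and ξ_{k+1}/ξ_k → 0; hence a_k → 0 at an R-superlinear rate. -/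
open Filter

theorem stmt_17 (β θ ξ ρ : ℕ → ℝ)
    (hβpos : ∀ k, 0 < β k) (hβdec : ∀ k, β (k + 1) < β k) (hβ0 : β 0 ≤ 1)
    (hβlim : Tendsto β atTop (nhds 0))
    (hθmem : ∀ k, θ k ∈ Set.Icc (0 : ℝ) 1) (hθmono : ∀ k, θ (k + 1) ≤ θ k)
    (hθlim : Tendsto θ atTop (nhds 0))
    (hξ0 : ξ 0 = 1)
    (hρ : ∀ k, ρ k = ξ k / 6 + θ k / 4 + β k ^ ((k : ℝ) / 4) / 2)
    (hξ : ∀ k, ξ (k + 1) = max (ξ k * ρ k) (β (k + 1) ^ (((k : ℝ) + 1) / 4)))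
    (C : ℝ) (hC : 0 < C)
    (a : ℕ → ℝ) (ha : ∀ k, 0 ≤ a k) (ha0 : a 0 ≤ C)
    (harec : ∀ k, a (k + 1) ≤ a k ^ 2 / (6 * C) + (θ k / 4) * a k + (C / 2) * β k ^ ((k : ℝ) / 2)) :
    (∀ k, a k ≤ C * ξ k) ∧ (∀ k, a k ≤ C) ∧
      Tendsto ξ atTop (nhds 0) ∧ Tendsto (fun k => ξ (k + 1) / ξ k) atTop (nhds 0) := by
  have hβanti : Antitone β := antitone_nat_of_succ_le fun k => (hβdec k).le
  have hβle : ∀ k, β k ≤ 1 := fun k => (hβanti (Nat.zero_le k)).trans hβ0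
  obtain ⟨b, hb⟩ : ∃ b : ℕ → ℝ, ∀ k, b k = β k ^ ((k : ℝ) / 4) := ⟨_, fun _ => rfl⟩
  have hξ' : ∀ k, ξ (k + 1) = max (ξ k * ρ k) (b (k + 1)) := by
    intro k
    rw [hξ, hb]
    push_cast
    rfl
  have hbpos : ∀ k, 0 < b k := fun k => by rw [hb]; exact Real.rpow_pos_of_pos (hβpos k) _
  have hble : ∀ k, b k ≤ 1 := fun k => by
    rw [hb]; exact Real.rpow_le_one (hβpos k).le (hβle k) (by positivity)
  have hbsq : ∀ k, β k ^ ((k : ℝ) / 2) = b k ^ 2 := fun k => by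
    rw [hb, ← Real.rpow_natCast, ← Real.rpow_mul (hβpos k).le]
    congr 1
    push_cast
    ring
  have hbsucc : ∀ k, b (k + 1) ≤ β k ^ (1 / 4 : ℝ) * b k := fun k => by
    rw [hb, hb, ← Real.rpow_add (hβpos k)]
    calc β (k + 1) ^ (((k + 1 : ℕ) : ℝ) / 4) ≤ β k ^ (((k + 1 : ℕ) : ℝ) / 4) :=
          Real.rpow_le_rpow (hβpos _).le (hβdec k).le (by positivity)
      _ = β k ^ (1 / 4 + (k : ℝ) / 4) := by
          congr 1
          push_cast
          ring
  have hbξ : ∀ k, b k ≤ ξ k := by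
    rintro (_ | k)
    · rw [hξ0]; exact hble 0
    · rw [hξ']; exact le_max_right _ _
  have hξpos : ∀ k, 0 < ξ k := fun k => (hbpos k).trans_le (hbξ k)
  have hρb : ∀ k, ρ k = ξ k / 6 + θ k / 4 + b k / 2 := fun k => by rw [hρ, hb]
  have hβrt : ∀ k, 0 ≤ β k ^ (1 / 4 : ℝ) := fun k => Real.rpow_nonneg (hβpos k).le _
  have hρle : ∀ k, ξ k ≤ 1 → ρ k ≤ 11 / 12 := fun k hk => by
    rw [hρb]
    linarith [(hθmem k).2, hble k]
  have hξle : ∀ k, ξ k ≤ 1 := by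
    intro k
    induction k with
    | zero => exact hξ0.le
    | succ k ih =>
      rw [hξ']
      refine max_le ?_ (hble _)
      nlinarith [hξpos k, hρle k ih]
  have hratio : ∀ k, ξ (k + 1) ≤ max (ρ k) (β k ^ (1 / 4 : ℝ)) * ξ k := fun k => by
    rw [hξ']
    refine max_le ?_ ?_
    · rw [mul_comm]
      exact mul_le_mul_of_nonneg_right (le_max_left _ _) (hξpos k).le
    · exact (hbsucc k).trans (mul_le_mul (le_max_right _ _) (hbξ k) (hbpos k).le
        ((hβrt k).trans (le_max_right _ _)))
  have haξ : ∀ k, a k ≤ C * ξ k := by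
    intro k
    induction k with
    | zero => rw [hξ0, mul_one]; exact ha0
    | succ k ih =>
      have h1 : a k ^ 2 / (6 * C) ≤ C * ξ k ^ 2 / 6 := by
        rw [div_le_iff₀ (by positivity)]
        calc a k ^ 2 ≤ (C * ξ k) ^ 2 := pow_le_pow_left₀ (ha k) ih 2
          _ = C * ξ k ^ 2 / 6 * (6 * C) := by ring
      have h2 : θ k / 4 * a k ≤ θ k / 4 * (C * ξ k) :=
        mul_le_mul_of_nonneg_left ih (by linarith [(hθmem k).1])
      have h3 : C / 2 * b k ^ 2 ≤ C / 2 * (ξ k * b k) := by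
        rw [sq]
        exact mul_le_mul_of_nonneg_left
          (mul_le_mul_of_nonneg_right (hbξ k) (hbpos k).le) (by positivity)
      have h4 := harec k
      rw [hbsq] at h4
      calc a (k + 1) ≤ C * (ξ k * ρ k) := by rw [hρb]; linarith
        _ ≤ C * ξ (k + 1) := by
          rw [hξ']
          exact mul_le_mul_of_nonneg_left (le_max_left _ _) hC.le
  have hβrtlim : Tendsto (fun k => β k ^ (1 / 4 : ℝ)) atTop (nhds 0) := by
    simpa using hβlim.rpow_const (p := (1 / 4 : ℝ)) (Or.inr (by norm_num))
  have hblim : Tendsto b atTop (nhds 0) := by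
    rw [← tendsto_add_atTop_iff_nat 1]
    exact squeeze_zero (fun k => (hbpos _).le)
      (fun k => (hbsucc k).trans (mul_le_of_le_one_right (hβrt k) (hble k))) hβrtlim
  have hξlim : Tendsto ξ atTop (nhds 0) := by
    obtain ⟨c, hc⟩ : ∃ c : ℝ, c = max (11 / 12) (β 1 ^ (1 / 4 : ℝ)) := ⟨_, rfl⟩
    have hc0 : 0 ≤ c := by rw [hc]; exact (hβrt 1).trans (le_max_right _ _)
    have hc1 : c < 1 := by
      rw [hc]
      exact max_lt (by norm_num)
        (Real.rpow_lt_one (hβpos 1).le ((hβdec 0).trans_le hβ0) (by norm_num))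
    have hgeom : ∀ k, ξ (k + 1) ≤ c ^ k := by
      intro k
      induction k with
      | zero => simpa using hξle 1
      | succ k ih =>
        have hle : max (ρ (k + 1)) (β (k + 1) ^ (1 / 4 : ℝ)) ≤ c := by
          rw [hc]
          exact max_le_max (hρle _ (hξle _))
            (Real.rpow_le_rpow (hβpos _).le (hβanti (by omega)) (by norm_num))
        calc ξ (k + 1 + 1) ≤ _ := hratio (k + 1)
          _ ≤ c * c ^ k := mul_le_mul hle ih (hξpos _).le hc0
          _ = c ^ (k + 1) := (pow_succ' c k).symm
    rw [← tendsto_add_atTop_iff_nat 1]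
    exact squeeze_zero (fun k => (hξpos _).le) hgeom (tendsto_pow_atTop_nhds_zero_of_lt_one hc0 hc1)
  have hρlim : Tendsto ρ atTop (nhds 0) := by
    rw [funext hρb]
    simpa using ((hξlim.div_const 6).add (hθlim.div_const 4)).add (hblim.div_const 2)
  refine ⟨haξ, fun k => (haξ k).trans (mul_le_of_le_one_right hC.le (hξle k)), hξlim, ?_⟩
  refine squeeze_zero (fun k => (div_pos (hξpos _) (hξpos k)).le)
    (fun k => (div_le_iff₀ (hξpos k)).2 (hratio k)) ?_
  simpa using hρlim.max hβrtlim
end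

section
/- Let ν ∈ (0, 1), ρ₀ ∈ (0, ν], A, B ≥ 0 with A + 2B ≤ ρ₀, κ > 0. Let {β_t}_{t∈ℕ} satisfy 0 < β_{t+1} < β_t ≤ 1 for all t, β_t → 0 and β₁ ≤ ρ₀⁴, and let {θ_t}_{t∈ℕ} ⊆ (0, 1] be nonincreasing with θ_t → 0. Define ξ₀ = 1, ρ_t := (A/2) ξ_t + B θ_t + (ρ₀/2) β_t^{t/4}, and ξ_{t+1} := max{ξ_t ρ_t, β_{t+1}^{(t+1)/4}}. Let {a_t}_{t∈ℕ} be nonnegative with a₀ ≤ κ and a_{t+1} ≤ (A/(2κ)) a_t² + B θ_t a_t + (κ ρ₀/2) β_t^{t/2} for all t. Then: (i) ρ_t ≤ ρ₀ ≤ ν for all t; (ii) ξ_t ≤ ν^t for all t; (iii) a_t ≤ κ ξ_t for all t; and (iv) ξ_{t+1}/ξ_t → 0, so a_t → 0 at an R-superlinear rate with the geometric envelope a_t ≤ κ ν^t. -/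
open Filter

theorem stmt_18 (ν ρ₀ A B κ : ℝ)
    (hν : ν ∈ Set.Ioo (0 : ℝ) 1) (hρ₀pos : 0 < ρ₀) (hρ₀ν : ρ₀ ≤ ν)
    (hA : 0 ≤ A) (hB : 0 ≤ B) (hAB : A + 2 * B ≤ ρ₀) (hκ : 0 < κ)
    (β θ ξ ρ : ℕ → ℝ)
    (hβpos : ∀ t, 0 < β t) (hβdec : ∀ t, β (t + 1) < β t) (hβle : ∀ t, β t ≤ 1)
    (hβlim : Tendsto β atTop (nhds 0)) (hβ1 : β 1 ≤ ρ₀ ^ 4)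
    (hθmem : ∀ t, θ t ∈ Set.Ioc (0 : ℝ) 1) (hθmono : ∀ t, θ (t + 1) ≤ θ t)
    (hθlim : Tendsto θ atTop (nhds 0))
    (hξ0 : ξ 0 = 1)
    (hρ : ∀ t, ρ t = (A / 2) * ξ t + B * θ t + (ρ₀ / 2) * β t ^ ((t : ℝ) / 4))
    (hξ : ∀ t, ξ (t + 1) = max (ξ t * ρ t) (β (t + 1) ^ (((t : ℝ) + 1) / 4)))
    (a : ℕ → ℝ) (ha : ∀ t, 0 ≤ a t) (ha0 : a 0 ≤ κ)
    (harec : ∀ t, a (t + 1) ≤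
      (A / (2 * κ)) * a t ^ 2 + B * θ t * a t + (κ * ρ₀ / 2) * β t ^ ((t : ℝ) / 2)) :
    (∀ t, ρ t ≤ ρ₀) ∧ (∀ t, ξ t ≤ ν ^ t) ∧ (∀ t, a t ≤ κ * ξ t) ∧
      Tendsto (fun t => ξ (t + 1) / ξ t) atTop (nhds 0) ∧ (∀ t, a t ≤ κ * ν ^ t) := by
  obtain ⟨hν0, hν1⟩ := hν
  have hρ₀1 : ρ₀ < 1 := hρ₀ν.trans_lt hν1
  set b : ℕ → ℝ := fun t => β t ^ ((t : ℝ) / 4) with hb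
  replace hρ : ∀ t, ρ t = (A / 2) * ξ t + B * θ t + (ρ₀ / 2) * b t := hρ
  replace hξ : ∀ t, ξ (t + 1) = max (ξ t * ρ t) (b (t + 1)) := fun t => by
    rw [hξ t]; simp only [hb]; push_cast; rfl
  have hb_pos : ∀ t, 0 < b t := fun t => Real.rpow_pos_of_pos (hβpos t) _
  have hb_le : ∀ t, b t ≤ ρ₀ ^ t := by
    rintro (_ | t)
    · simp [hb]
    · have hβt : β (t + 1) ≤ ρ₀ ^ 4 :=
        ((strictAnti_nat_of_succ_lt hβdec).antitone (by omega)).trans hβ1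
      calc b (t + 1) ≤ (ρ₀ ^ 4) ^ (((t + 1 : ℕ) : ℝ) / 4) :=
            Real.rpow_le_rpow (hβpos _).le hβt (by positivity)
        _ = ρ₀ ^ (t + 1) := by
            rw [← Real.rpow_natCast ρ₀ 4, ← Real.rpow_mul hρ₀pos.le, ← Real.rpow_natCast]
            congr 1
            push_cast
            ring
  have hb_sq : ∀ t, β t ^ ((t : ℝ) / 2) = b t ^ 2 := fun t => by
    simp only [hb]
    rw [← Real.rpow_natCast, ← Real.rpow_mul (hβpos t).le]
    congr 1
    push_cast
    ring
  have hb_succ : ∀ t, b (t + 1) ≤ b t * β (t + 1) ^ (1 / 4 : ℝ) := fun t => by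
    calc b (t + 1) = β (t + 1) ^ ((t : ℝ) / 4) * β (t + 1) ^ (1 / 4 : ℝ) := by
          simp only [hb]
          rw [← Real.rpow_add (hβpos _)]
          congr 1
          push_cast
          ring
      _ ≤ _ := mul_le_mul_of_nonneg_right
          (Real.rpow_le_rpow (hβpos _).le (hβdec t).le (by positivity))
          (Real.rpow_nonneg (hβpos _).le _)
  have hb_le_ξ : ∀ t, b t ≤ ξ t := by
    rintro (_ | t)
    · simp [hb, hξ0]
    · rw [hξ t]; exact le_max_right _ _
  have hξ_pos : ∀ t, 0 < ξ t := fun t => (hb_pos t).trans_le (hb_le_ξ t)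
  have hρ_le_of : ∀ t, ξ t ≤ ρ₀ ^ t → ρ t ≤ ρ₀ := fun t ht => by
    have hpow : ρ₀ ^ t ≤ 1 := pow_le_one₀ hρ₀pos.le hρ₀1.le
    have h₁ := mul_le_mul_of_nonneg_left (ht.trans hpow) hA
    have h₂ := mul_le_mul_of_nonneg_left (hθmem t).2 hB
    have h₃ := mul_le_mul_of_nonneg_left ((hb_le t).trans hpow) hρ₀pos.le
    rw [hρ t]
    linarith
  have hξ_le : ∀ t, ξ t ≤ ρ₀ ^ t := by
    intro t
    induction t with
    | zero => simp [hξ0]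
    | succ t ih =>
      rw [hξ t]
      refine max_le ?_ (hb_le _)
      rw [pow_succ]
      exact (mul_le_mul_of_nonneg_left (hρ_le_of t ih) (hξ_pos t).le).trans
        (mul_le_mul_of_nonneg_right ih hρ₀pos.le)
  have hξ_le_ν : ∀ t, ξ t ≤ ν ^ t := fun t =>
    (hξ_le t).trans (pow_le_pow_left₀ hρ₀pos.le hρ₀ν t)
  have ha_le : ∀ t, a t ≤ κ * ξ t := by
    intro t
    induction t with
    | zero => simpa [hξ0] using ha0
    | succ t ih =>
      have hθ := (hθmem t).1.le
      have hbξ : b t ^ 2 ≤ ξ t * b t := by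
        rw [sq]; exact mul_le_mul_of_nonneg_right (hb_le_ξ t) (hb_pos t).le
      calc a (t + 1)
          ≤ (A / (2 * κ)) * a t ^ 2 + B * θ t * a t + (κ * ρ₀ / 2) * b t ^ 2 := by
            rw [← hb_sq]; exact harec t
        _ ≤ (A / (2 * κ)) * (κ * ξ t) ^ 2 + B * θ t * (κ * ξ t)
              + (κ * ρ₀ / 2) * (ξ t * b t) := by
            have := ha t
            gcongr
        _ = κ * (ξ t * ρ t) := by
            rw [hρ t]
            field_simp
        _ ≤ κ * ξ (t + 1) := by
            rw [hξ t]
            exact mul_le_mul_of_nonneg_left (le_max_left _ _) hκ.le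
  have hξ_lim : Tendsto ξ atTop (nhds 0) :=
    squeeze_zero (fun t => (hξ_pos t).le) hξ_le_ν
      (tendsto_pow_atTop_nhds_zero_of_lt_one hν0.le hν1)
  have hb_lim : Tendsto b atTop (nhds 0) :=
    squeeze_zero (fun t => (hb_pos t).le) hb_le_ξ hξ_lim
  have hρ_lim : Tendsto ρ atTop (nhds 0) := by
    rw [funext hρ]
    simpa using ((hξ_lim.const_mul (A / 2)).add (hθlim.const_mul B)).add
      (hb_lim.const_mul (ρ₀ / 2))
  have hroot_lim : Tendsto (fun t => β (t + 1) ^ (1 / 4 : ℝ)) atTop (nhds 0) := by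
    simpa using ((tendsto_add_atTop_iff_nat 1).2 hβlim).rpow_const
      (p := (1 / 4 : ℝ)) (Or.inr (by norm_num))
  have hratio_le : ∀ t, ξ (t + 1) / ξ t ≤ max (ρ t) (β (t + 1) ^ (1 / 4 : ℝ)) := fun t => by
    rw [div_le_iff₀ (hξ_pos t), hξ t, mul_comm (ξ t), max_mul_of_nonneg _ _ (hξ_pos t).le]
    refine max_le_max le_rfl ((hb_succ t).trans ?_)
    rw [mul_comm]
    exact mul_le_mul_of_nonneg_left (hb_le_ξ t) (Real.rpow_nonneg (hβpos _).le _)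
  refine ⟨fun t => hρ_le_of t (hξ_le t), hξ_le_ν, ha_le, ?_, fun t =>
    (ha_le t).trans (mul_le_mul_of_nonneg_left (hξ_le_ν t) hκ.le)⟩
  exact squeeze_zero (fun t => (div_pos (hξ_pos _) (hξ_pos t)).le) hratio_le
    (by simpa using hρ_lim.max hroot_lim)
end
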